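/- Let W_1, ..., W_T be a stochastic process adapted to a filtration (F_t) with 0 ≤ W_t ≤ 1 almost surely. Then for any δ ∈ (0,1) and λ ∈ (0,1], with probability at least 1 − δ, the sum ∑_{t=1}^T W_t is at most ((e^λ − 1)/λ) · ∑_{t=1}^T E[W_t | F_{t−1}] + log(1/δ)/λ. -/

import Mathlib

open MeasureTheory Real Finset

lemma chord_exp (lam w : ℝ) (h0 : 0 ≤ w) (h1 : w ≤ 1) :
    Real.exp (lam * w) ≤ 1 + (Real.exp lam - 1) * w := by
  have h := convexOn_exp.2 (Set.mem_univ (0 : ℝ)) (Set.mem_univ lam)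
    (sub_nonneg.2 h1) h0 (by ring)
  simp only [smul_eq_mul, mul_zero, zero_add, Real.exp_zero, mul_one] at h
  rw [mul_comm w lam] at h
  linarith

lemma one_step {Ω : Type*} {m m0 : MeasurableSpace Ω} (μ : Measure Ω) [IsProbabilityMeasure μ]
    (hm : m ≤ m0) (M W : Ω → ℝ) (K lam : ℝ) (hlam : 0 < lam)
    (hM : StronglyMeasurable[m] M) (hM0 : ∀ ω, 0 ≤ M ω) (hMK : ∀ᵐ ω ∂μ, M ω ≤ K)
    (hW : StronglyMeasurable W)
    (hb : ∀ᵐ ω ∂μ, W ω ∈ Set.Icc (0 : ℝ) 1) :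
    ∫ ω, M ω * Real.exp (lam * W ω - (Real.exp lam - 1) * (μ[W | m]) ω) ∂μ ≤ ∫ ω, M ω ∂μ := by
  set c := Real.exp lam - 1 with hc
  have hc0 : 0 < c := by have := Real.add_one_lt_exp hlam.ne'; linarith
  have hWi : Integrable W μ := by
    refine Integrable.of_bound hW.aestronglyMeasurable 1 ?_
    filter_upwards [hb] with ω h
    rw [Real.norm_eq_abs, abs_of_nonneg h.1]; exact h.2
  have hE0 : 0 ≤ᵐ[μ] μ[W | m] := condExp_nonneg (hb.mono fun ω h => h.1)
  have hEm : StronglyMeasurable[m] (μ[W | m]) := stronglyMeasurable_condExp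
  set G : Ω → ℝ := fun ω => M ω * Real.exp (-(c * (μ[W | m]) ω)) with hG
  have hGm : StronglyMeasurable[m] G :=
    hM.mul (Real.continuous_exp.comp_stronglyMeasurable (hEm.const_mul c).neg)
  have hG0 : ∀ ω, 0 ≤ G ω := fun ω => mul_nonneg (hM0 ω) (Real.exp_pos _).le
  have hGM : ∀ᵐ ω ∂μ, G ω ≤ M ω := by
    filter_upwards [hE0] with ω h
    refine mul_le_of_le_one_right (hM0 ω) (Real.exp_le_one_iff.2 ?_)
    have := mul_nonneg hc0.le h
    simpa using this
  have hMi : Integrable M μ := by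
    refine Integrable.of_bound (hM.mono hm).aestronglyMeasurable K ?_
    filter_upwards [hMK] with ω h
    rwa [Real.norm_eq_abs, abs_of_nonneg (hM0 ω)]
  have hGi : Integrable G μ := by
    refine hMi.mono (hGm.mono hm).aestronglyMeasurable ?_
    filter_upwards [hGM] with ω h
    rwa [Real.norm_eq_abs, Real.norm_eq_abs, abs_of_nonneg (hM0 ω), abs_of_nonneg (hG0 ω)]
  have hGWi : Integrable (G * W) μ := by
    refine hGi.mono ((hGm.mono hm).mul hW).aestronglyMeasurable ?_
    filter_upwards [hb] with ω h
    rw [Pi.mul_apply, norm_mul, Real.norm_eq_abs (W ω), abs_of_nonneg h.1]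
    exact mul_le_of_le_one_right (norm_nonneg _) h.2
  have hpull : μ[G * W | m] =ᵐ[μ] G * μ[W | m] :=
    condExp_mul_of_stronglyMeasurable_left hGm hGWi hWi
  have hGEi : Integrable (G * μ[W | m]) μ := integrable_condExp.congr hpull
  have heq : ∫ ω, (G * W) ω ∂μ = ∫ ω, (G * μ[W | m]) ω ∂μ := by
    rw [← integral_condExp hm]
    exact integral_congr_ae hpull
  calc ∫ ω, M ω * Real.exp (lam * W ω - c * (μ[W | m]) ω) ∂μ
      ≤ ∫ ω, (G ω + c * (G * W) ω) ∂μ := by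
        refine integral_mono_of_nonneg
          (ae_of_all _ fun ω => mul_nonneg (hM0 ω) (Real.exp_pos _).le)
          (hGi.add (hGWi.const_mul c)) ?_
        filter_upwards [hb] with ω h
        have h1 := mul_le_mul_of_nonneg_left (chord_exp lam (W ω) h.1 h.2) (hG0 ω)
        have h2 : M ω * Real.exp (lam * W ω - c * (μ[W | m]) ω)
            = G ω * Real.exp (lam * W ω) := by
          rw [hG, sub_eq_add_neg, Real.exp_add]; ring
        rw [h2, Pi.mul_apply]
        refine h1.trans (le_of_eq ?_)
        rw [hc]; ring
    _ = ∫ ω, (G ω + c * (G * μ[W | m]) ω) ∂μ := by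
        rw [integral_add hGi (hGWi.const_mul c), integral_add hGi (hGEi.const_mul c),
          integral_const_mul, integral_const_mul, heq]
    _ ≤ ∫ ω, M ω ∂μ := by
        refine integral_mono (hGi.add (hGEi.const_mul c)) hMi fun ω => ?_
        have h1 := mul_le_mul_of_nonneg_left (Real.add_one_le_exp (c * (μ[W | m]) ω)) (hG0 ω)
        have h2 : G ω * Real.exp (c * (μ[W | m]) ω) = M ω := by
          rw [hG]; simp only []
          rw [mul_assoc, ← Real.exp_add]; simp
        rw [h2] at h1
        refine le_trans (le_of_eq ?_) h1
        rw [Pi.mul_apply]; ring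

/-- Martingale Chernoff bound (upper tail): for an adapted `[0,1]`-bounded process
`W_1, ..., W_T`, with probability at least `1 - δ`,
`∑ W_t ≤ ((e^λ - 1)/λ) ∑ E[W_t | F_{t-1}] + log(1/δ)/λ`. -/
theorem stmt0 {Ω : Type*} {m0 : MeasurableSpace Ω} (μ : Measure Ω) [IsProbabilityMeasure μ]
    (T : ℕ) (ℱ : Filtration ℕ m0) (W : ℕ → Ω → ℝ)
    (hadapted : Adapted ℱ W)
    (hbdd : ∀ t, ∀ᵐ ω ∂μ, W t ω ∈ Set.Icc (0 : ℝ) 1)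
    (δ lam : ℝ) (hδ : δ ∈ Set.Ioo (0 : ℝ) 1) (hlam : lam ∈ Set.Ioc (0 : ℝ) 1) :
    ENNReal.ofReal (1 - δ) ≤
      μ {ω | ∑ t ∈ Finset.Icc 1 T, W t ω ≤
        ((Real.exp lam - 1) / lam) * ∑ t ∈ Finset.Icc 1 T, (μ[W t | ℱ (t - 1)]) ω
          + Real.log (1 / δ) / lam} := by
  obtain ⟨hl0, -⟩ := hlam
  obtain ⟨hd0, hd1⟩ := hδ
  set c := Real.exp lam - 1 with hc
  have hc0 : 0 < c := by have := Real.add_one_lt_exp hl0.ne'; linarith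
  have hWs : ∀ t, StronglyMeasurable[ℱ t] (W t) := fun t => (hadapted t).stronglyMeasurable
  set S : ℕ → Ω → ℝ := fun n ω =>
    ∑ t ∈ Finset.Icc 1 n, (lam * W t ω - c * (μ[W t | ℱ (t - 1)]) ω) with hS
  set M : ℕ → Ω → ℝ := fun n ω => Real.exp (S n ω) with hMdef
  have hSm : ∀ n, StronglyMeasurable[ℱ n] (S n) := by
    intro n
    refine Finset.stronglyMeasurable_fun_sum _ fun t ht => ?_
    have ht' := (Finset.mem_Icc.1 ht).2
    exact (((hWs t).mono (ℱ.mono ht')).const_mul lam).sub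
      ((stronglyMeasurable_condExp.mono (ℱ.mono (by omega))).const_mul c)
  have hMm : ∀ n, StronglyMeasurable[ℱ n] (M n) := fun n =>
    Real.continuous_exp.comp_stronglyMeasurable (hSm n)
  have hMK : ∀ n, ∀ᵐ ω ∂μ, M n ω ≤ Real.exp (∑ t ∈ Finset.Icc 1 n, lam) := by
    intro n
    have hE : ∀ᵐ ω ∂μ, ∀ t, 0 ≤ (μ[W t | ℱ (t - 1)]) ω :=
      ae_all_iff.2 fun t => condExp_nonneg ((hbdd t).mono fun ω h => h.1)
    filter_upwards [ae_all_iff.2 hbdd, hE] with ω h1 h2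
    refine Real.exp_le_exp.2 (Finset.sum_le_sum fun t _ => ?_)
    have := mul_nonneg hc0.le (h2 t)
    have := mul_le_mul_of_nonneg_left (h1 t).2 hl0.le
    linarith
  have hint : ∀ n, ∫ ω, M n ω ∂μ ≤ 1 := by
    intro n
    induction n with
    | zero => simp [hMdef, hS]
    | succ n ih =>
      refine le_trans (le_of_eq ?_) ((one_step μ (ℱ.le n) (M n) (W (n + 1)) _ lam hl0 (hMm n)
        (fun ω => (Real.exp_pos _).le) (hMK n) ((hWs (n + 1)).mono (ℱ.le _))
        (hbdd (n + 1))).trans ih)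
      refine integral_congr_ae (ae_of_all _ fun ω => ?_)
      simp only [hMdef, hS]
      rw [Finset.sum_Icc_succ_top (by omega), Real.exp_add]
      simp [hc]
  have hMi : Integrable (M T) μ := by
    refine Integrable.of_bound ((hMm T).mono (ℱ.le T)).aestronglyMeasurable
      (Real.exp (∑ t ∈ Finset.Icc 1 T, lam)) ?_
    filter_upwards [hMK T] with ω h
    rwa [Real.norm_eq_abs, abs_of_nonneg (Real.exp_pos _).le]
  have hmk := mul_meas_ge_le_integral_of_nonneg
    (ae_of_all μ fun ω => (Real.exp_pos (S T ω)).le) hMi (1 / δ)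
  have hB : μ.real {ω | 1 / δ ≤ M T ω} ≤ δ := by
    have h := hmk.trans (hint T)
    rw [one_div, inv_mul_le_iff₀ hd0, mul_one] at h
    simpa [one_div] using h
  have hms : MeasurableSet {ω | 1 / δ ≤ M T ω} :=
    measurableSet_le measurable_const ((hMm T).mono (ℱ.le T)).measurable
  have hcompl : 1 - δ ≤ μ.real {ω | 1 / δ ≤ M T ω}ᶜ := by
    rw [probReal_compl_eq_one_sub hms]; linarith
  refine (ENNReal.ofReal_le_ofReal hcompl).trans ?_
  rw [ofReal_measureReal]
  refine measure_mono fun ω hω => ?_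
  simp only [Set.mem_compl_iff, Set.mem_setOf_eq, not_le] at hω ⊢
  have h1 : S T ω < Real.log (1 / δ) := (Real.lt_log_iff_exp_lt (by positivity)).2 hω
  simp only [hS, Finset.sum_sub_distrib, ← Finset.mul_sum] at h1
  rw [div_mul_eq_mul_div, ← add_div, le_div_iff₀ hl0]
  linarith
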